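/- arXiv:1303.3025 — 2 statements merged into one kernel-verified Lean document; each statement's English description precedes it below -/
import Mathlib

section
/- Let X be a ℂ-vector space, f a ℂ-linear endomorphism of X, and n : ℕ. For each k < n define the ℂ-linear endomorphism G_k of (Fin (2^n) → X) by (G_k v) j = if Nat.testBit (j : ℕ) k then f^(2^k) (v j) else v j. Then: (i) the maps G_k pairwise commute; (ii) the iterator !^{2^n}(f) equals the composition G_{n-1} ∘ ⋯ ∘ G_1 ∘ G_0; equivalently, for all v : Fin (2^n) → X and all j, f^(j : ℕ) (v j) = ((G_{n-1} ∘ ⋯ ∘ G_0) v) j. -/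
/-- The iterator `!^N(f)`: the `ℂ`-linear endomorphism of `Fin N → X` acting as
`(!^N(f) v) j = f^j (v j)`, i.e. the direct sum `⊕_{j<N} f^j`. -/
def bang (X : Type*) [AddCommGroup X] [Module ℂ X] (N : ℕ) (f : Module.End ℂ X) :
    Module.End ℂ (Fin N → X) :=
  LinearMap.pi fun j => (f ^ (j : ℕ)) ∘ₗ LinearMap.proj j

/-- The gate `G_k`: apply `f^(2^k)` at index `j` exactly when the `k`-th binary digit of `j`
is `1`, i.e. `(G_k v) j = if Nat.testBit j k then f^(2^k) (v j) else v j`. -/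
def gate (X : Type*) [AddCommGroup X] [Module ℂ X] (N : ℕ) (f : Module.End ℂ X) (k : ℕ) :
    Module.End ℂ (Fin N → X) :=
  LinearMap.pi fun j =>
    (if Nat.testBit (j : ℕ) k then f ^ (2 ^ k) else LinearMap.id) ∘ₗ LinearMap.proj j

theorem gate_apply (X : Type*) [AddCommGroup X] [Module ℂ X] (N : ℕ) (f : Module.End ℂ X)
    (k : ℕ) (v : Fin N → X) (j : Fin N) :
    gate X N f k v j = (f ^ (2 ^ k * (Nat.testBit (j : ℕ) k).toNat)) (v j) := by
  cases h : Nat.testBit (j : ℕ) k <;> simp [gate, h]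

theorem gate_comm (X : Type*) [AddCommGroup X] [Module ℂ X] (N : ℕ) (f : Module.End ℂ X)
    (k l : ℕ) : gate X N f k ∘ₗ gate X N f l = gate X N f l ∘ₗ gate X N f k := by
  refine LinearMap.ext fun v => funext fun j => ?_
  simp only [LinearMap.comp_apply, gate_apply]
  rw [← Module.End.mul_apply, ← Module.End.mul_apply, ← pow_add, ← pow_add, add_comm]

theorem Nat.mod_two_pow_succ_eq_add_testBit (j n : ℕ) :
    j % 2 ^ (n + 1) = 2 ^ n * (j.testBit n).toNat + j % 2 ^ n := by
  rw [Nat.mod_pow_succ, Nat.toNat_testBit, add_comm]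

/-- Composing the first `n` gates applies `f` as many times as the number formed by the
lowest `n` binary digits of the index. -/
theorem foldl_gate_apply (X : Type*) [AddCommGroup X] [Module ℂ X] (N : ℕ)
    (f : Module.End ℂ X) (n : ℕ) (v : Fin N → X) (j : Fin N) :
    ((List.range n).foldl (fun acc k => gate X N f k ∘ₗ acc) LinearMap.id) v j =
      (f ^ ((j : ℕ) % 2 ^ n)) (v j) := by
  induction n with
  | zero => simp [Nat.mod_one]
  | succ n ih =>
    rw [List.range_succ, List.foldl_append, List.foldl_cons, List.foldl_nil,
      LinearMap.comp_apply, gate_apply, ih, ← Module.End.mul_apply, ← pow_add,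
      ← Nat.mod_two_pow_succ_eq_add_testBit]

/-- (i) the gates `G_k` for `k < n` pairwise commute;
(ii) the iterator `!^{2^n}(f)` equals the composite `G_{n-1} ∘ ⋯ ∘ G_1 ∘ G_0`;
equivalently, `f^j (v j) = ((G_{n-1} ∘ ⋯ ∘ G_0) v) j` for all `v` and `j`. -/
theorem stmt8 (X : Type*) [AddCommGroup X] [Module ℂ X] (f : Module.End ℂ X) (n : ℕ) :
    (∀ k l : ℕ, k < n → l < n →
      gate X (2 ^ n) f k ∘ₗ gate X (2 ^ n) f l = gate X (2 ^ n) f l ∘ₗ gate X (2 ^ n) f k) ∧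
    (bang X (2 ^ n) f =
      (List.range n).foldl (fun acc k => gate X (2 ^ n) f k ∘ₗ acc) LinearMap.id) ∧
    (∀ (v : Fin (2 ^ n) → X) (j : Fin (2 ^ n)),
      (f ^ (j : ℕ)) (v j) =
        ((List.range n).foldl (fun acc k => gate X (2 ^ n) f k ∘ₗ acc) LinearMap.id) v j) := by
  have key (v : Fin (2 ^ n) → X) (j : Fin (2 ^ n)) :
      (f ^ (j : ℕ)) (v j) =
        ((List.range n).foldl (fun acc k => gate X (2 ^ n) f k ∘ₗ acc) LinearMap.id) v j := by
    rw [foldl_gate_apply, Nat.mod_eq_of_lt j.isLt]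
  exact ⟨fun k l _ _ => gate_comm X (2 ^ n) f k l,
    LinearMap.ext fun v => funext fun j => key v j, key⟩
end

section
/- Let K : ℕ with K ≥ 1, let r be a unit of ZMod K, and let n : ℕ. Define the oracle O as the ℂ-linear endomorphism of ((Fin (2^n) × ZMod K) → ℂ) given by (O v) (x, p) = v (x, ((r^(x : ℕ))⁻¹ : (ZMod K)ˣ) * p), and for each k < n define the gate G_k by (G_k v) (x, p) = if Nat.testBit (x : ℕ) k then v (x, ((r^(2^k))⁻¹ : (ZMod K)ˣ) * p) else v (x, p). Then O = G_{n-1} ∘ ⋯ ∘ G_1 ∘ G_0, and the gates G_k pairwise commute. Moreover O (Pi.single (x, 1) 1) = Pi.single (x, (r : ZMod K)^(x : ℕ)) 1 for every x : Fin (2^n). -/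
/-- The modular exponentiation oracle of Shor's algorithm, acting on the control register
`Fin (2^n)` tensored with the target register `ℂ^{ZMod K}`:
`(O v) (x, p) = v (x, (r^x)⁻¹ * p)`, so on basis states `|x⟩|p⟩ ↦ |x⟩|r^x · p⟩`. -/
noncomputable def oracle (K : ℕ) (r : (ZMod K)ˣ) (n : ℕ) :
    Module.End ℂ ((Fin (2 ^ n) × ZMod K) → ℂ) :=
  LinearMap.funLeft ℂ ℂ fun q : Fin (2 ^ n) × ZMod K =>
    (q.1, (((r ^ (q.1 : ℕ))⁻¹ : (ZMod K)ˣ) : ZMod K) * q.2)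

/-- The gate `G_k`: multiplication by `r^{2^k}` on the target register, controlled on the
`k`-th bit of the control index `x`:
`(G_k v) (x, p) = if Nat.testBit x k then v (x, (r^{2^k})⁻¹ * p) else v (x, p)`. -/
noncomputable def shorGate (K : ℕ) (r : (ZMod K)ˣ) (n : ℕ) (k : ℕ) :
    Module.End ℂ ((Fin (2 ^ n) × ZMod K) → ℂ) :=
  LinearMap.funLeft ℂ ℂ fun q : Fin (2 ^ n) × ZMod K =>
    if Nat.testBit (q.1 : ℕ) k
      then (q.1, (((r ^ (2 ^ k))⁻¹ : (ZMod K)ˣ) : ZMod K) * q.2)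
      else q

/-- Multiplication of the target register by the unit `f x`, controlled on the index `x`. -/
noncomputable def controlledMul {K : ℕ} {ι : Type*} (f : ι → (ZMod K)ˣ) :
    Module.End ℂ ((ι × ZMod K) → ℂ) :=
  LinearMap.funLeft ℂ ℂ fun q : ι × ZMod K => (q.1, (((f q.1)⁻¹ : (ZMod K)ˣ) : ZMod K) * q.2)

section controlledMul

variable {K : ℕ} {ι : Type*}

theorem controlledMul_apply (f : ι → (ZMod K)ˣ) (v : ι × ZMod K → ℂ) (q : ι × ZMod K) :
    controlledMul f v q = v (q.1, (((f q.1)⁻¹ : (ZMod K)ˣ) : ZMod K) * q.2) :=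
  rfl

theorem controlledMul_one : controlledMul (1 : ι → (ZMod K)ˣ) = LinearMap.id := by
  ext1 v
  funext q
  simp [controlledMul_apply]

theorem controlledMul_comp (f g : ι → (ZMod K)ˣ) :
    controlledMul f ∘ₗ controlledMul g = controlledMul (f * g) := by
  refine LinearMap.ext fun v => funext fun q => ?_
  simp [controlledMul_apply, mul_comm, mul_assoc]

theorem controlledMul_single [DecidableEq ι] (f : ι → (ZMod K)ˣ) (x : ι) (p : ZMod K) :
    controlledMul f (Pi.single (x, p) 1) = Pi.single (x, (f x : ZMod K) * p) 1 := by
  funext ⟨y, s⟩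
  simp only [controlledMul_apply, Pi.single_apply, Prod.mk.injEq]
  refine if_congr (and_congr_right ?_) rfl rfl
  rintro rfl
  exact Units.inv_mul_eq_iff_eq_mul _

end controlledMul

theorem oracle_eq_controlledMul (K : ℕ) (r : (ZMod K)ˣ) (n : ℕ) :
    oracle K r n = controlledMul fun x : Fin (2 ^ n) => r ^ (x : ℕ) :=
  rfl

theorem shorGate_eq_controlledMul (K : ℕ) (r : (ZMod K)ˣ) (n k : ℕ) :
    shorGate K r n k = controlledMul fun x : Fin (2 ^ n) =>
      if Nat.testBit (x : ℕ) k then r ^ (2 ^ k) else 1 := by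
  refine LinearMap.ext fun v => funext fun q => ?_
  simp only [shorGate, LinearMap.funLeft_apply, controlledMul_apply]
  split_ifs <;> simp

theorem pow_mod_two_pow_succ {M : Type*} [Monoid M] (r : M) (x m : ℕ) :
    r ^ (x % 2 ^ (m + 1)) = (if x.testBit m then r ^ (2 ^ m) else 1) * r ^ (x % 2 ^ m) := by
  rw [Nat.mod_pow_succ, add_comm, pow_add, ← Nat.toNat_testBit]
  cases x.testBit m <;> simp

theorem foldl_shorGate (K : ℕ) (r : (ZMod K)ˣ) (n m : ℕ) :
    (List.range m).foldl (fun acc k => shorGate K r n k ∘ₗ acc) LinearMap.id =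
      controlledMul fun x : Fin (2 ^ n) => r ^ ((x : ℕ) % 2 ^ m) := by
  induction m with
  | zero =>
    simp only [pow_zero, Nat.mod_one]
    exact controlledMul_one.symm
  | succ m ih =>
    rw [List.range_succ, List.foldl_append, ih, List.foldl_cons, List.foldl_nil,
      shorGate_eq_controlledMul, controlledMul_comp]
    congr 1
    funext x
    exact (pow_mod_two_pow_succ r x m).symm

/-- the oracle `O` factors as `G_{n-1} ∘ ⋯ ∘ G_1 ∘ G_0`; the gates `G_k`
pairwise commute; and `O (Pi.single (x, 1) 1) = Pi.single (x, r^x) 1` for every `x`. -/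
theorem stmt13 (K : ℕ) (hK : 1 ≤ K) (r : (ZMod K)ˣ) (n : ℕ) :
    (oracle K r n =
      (List.range n).foldl (fun acc k => shorGate K r n k ∘ₗ acc) LinearMap.id) ∧
    (∀ k l : ℕ, k < n → l < n →
      shorGate K r n k ∘ₗ shorGate K r n l = shorGate K r n l ∘ₗ shorGate K r n k) ∧
    (∀ x : Fin (2 ^ n),
      oracle K r n (Pi.single (x, (1 : ZMod K)) 1)
        = Pi.single (x, (r : ZMod K) ^ (x : ℕ)) 1) := by
  refine ⟨?_, fun k l _ _ => ?_, fun x => ?_⟩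
  · simp only [foldl_shorGate, Nat.mod_eq_of_lt (Fin.is_lt _), oracle_eq_controlledMul]
  · simp only [shorGate_eq_controlledMul, controlledMul_comp, mul_comm]
  · simp [oracle_eq_controlledMul, controlledMul_single]
end
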